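/- Let d ≥ 2 be an integer and p ∈ ℝ. For every smooth function f : ℝ^{d-1} × ℝ → ℝ with compact support contained in ℝ^{d-1} × (0,∞), and for every x ∈ ℝ^{d-1} and y > 0, the second filtered back-projection formula holds: f(x, y) = (1 / (2π)^{d-1}) · ∫_{ℝ^{d-1}} (|u − x|² + y²)^{(p−1)/2} · |u − x|^{-(d-2)} · g(u, arctan(|u − x| / y)) du, where g(u, θ) := (2π)^{1-d} ∫_{ℝ^{d-1}} |k|^{d-1} (F R^(p) f)(k, θ) e^{i⟨k,u⟩} dk is the Riesz-filtered data. -/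

import Mathlib

open MeasureTheory Real Metric
open scoped RealInnerProductSpace

noncomputable section

/-- The standard surface measure on the unit sphere `S^{d-2} ⊆ ℝ^{d-1}`
(for `d = 2` this is the counting measure on `S^0 = {±1}`). -/
def sphereMeasure (d : ℕ) : Measure (sphere (0 : EuclideanSpace ℝ (Fin (d - 1))) 1) :=
  (volume : Measure (EuclideanSpace ℝ (Fin (d - 1)))).toSphere

/-- The conical Radon transform with radial weight `1/s^p`:
`(R^(p) f)(u, θ) = ∫_0^∞ s^(-p) ∫_{S^{d-2}} f(u + s sin θ n, s cos θ) (s sin θ)^(d-2) dn ds`. -/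
def coneRadon (d : ℕ) (p : ℝ) (f : EuclideanSpace ℝ (Fin (d - 1)) × ℝ → ℝ)
    (u : EuclideanSpace ℝ (Fin (d - 1))) (θ : ℝ) : ℝ :=
  ∫ s in Set.Ioi (0 : ℝ),
    s ^ (-p) *
      ∫ n, f (u + (s * Real.sin θ) • (n : EuclideanSpace ℝ (Fin (d - 1))), s * Real.cos θ) *
          (s * Real.sin θ) ^ (d - 2) ∂(sphereMeasure d)

/-- Fourier transform in the first argument:
`(F g)(k, θ) = ∫_{ℝ^{d-1}} e^{-i⟨k,u⟩} g(u, θ) du`. -/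
def fourierFirst (d : ℕ) (g : EuclideanSpace ℝ (Fin (d - 1)) → ℝ → ℝ)
    (k : EuclideanSpace ℝ (Fin (d - 1))) (θ : ℝ) : ℂ :=
  ∫ u, Complex.exp (-Complex.I * (⟪k, u⟫ : ℝ)) * (g u θ : ℂ)

/-- The Riesz-filtered data
`g(u, θ) = (2π)^(1-d) ∫_{ℝ^{d-1}} |k|^(d-1) (F R^(p) f)(k, θ) e^{i⟨k,u⟩} dk`. -/
def filteredData (d : ℕ) (p : ℝ) (f : EuclideanSpace ℝ (Fin (d - 1)) × ℝ → ℝ)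
    (u : EuclideanSpace ℝ (Fin (d - 1))) (θ : ℝ) : ℂ :=
  (((2 * π) ^ ((1 : ℤ) - (d : ℤ)) : ℝ) : ℂ) *
    ∫ k, ((‖k‖ ^ (d - 1) : ℝ) : ℂ) * fourierFirst d (coneRadon d p f) k θ *
      Complex.exp (Complex.I * (⟪k, u⟫ : ℝ))

section Angular
open FourierTransform
open scoped ContDiff

theorem hasCompactSupport_comp_ofLp {V : Type*} [NormedAddCommGroup V] [InnerProductSpace ℝ V]
    {Φ : V × V → ℂ} (hs : HasCompactSupport Φ) :
    HasCompactSupport (fun z : WithLp 2 (V × V) ↦ Φ (WithLp.ofLp z)) :=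
  hs.comp_homeomorph (WithLp.prodContinuousLinearEquiv 2 ℝ V V).toHomeomorph

theorem contDiff_comp_ofLp {V : Type*} [NormedAddCommGroup V] [InnerProductSpace ℝ V]
    {Φ : V × V → ℂ} (hd : ContDiff ℝ ∞ Φ) :
    ContDiff ℝ ∞ (fun z : WithLp 2 (V × V) ↦ Φ (WithLp.ofLp z)) :=
  hd.comp (WithLp.prodContinuousLinearEquiv 2 ℝ V V).contDiff

variable {V : Type*} [NormedAddCommGroup V] [InnerProductSpace ℝ V] [FiniteDimensional ℝ V]
  [MeasurableSpace V] [BorelSpace V]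

/-- The Fourier transform normalized with angular frequency, `k ↦ ∫ e^{-i⟨k,v⟩} h(v) dv`. -/
def angularFourier (h : V → ℂ) (k : V) : ℂ :=
  ∫ v, Complex.exp (-Complex.I * (⟪k, v⟫ : ℝ)) * h v

theorem angularFourier_two_pi_smul (h : V → ℂ) (k : V) :
    angularFourier h ((2 * π) • k) = 𝓕 h k := by
  rw [Real.fourier_eq', angularFourier]
  refine integral_congr_ae (.of_forall fun v ↦ ?_)
  simp only [smul_eq_mul, real_inner_smul_left, real_inner_comm k v]
  congr 2
  push_cast
  ring

theorem angularFourier_eq (h : V → ℂ) :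
    angularFourier h = fun k ↦ 𝓕 h ((2 * π)⁻¹ • k) := by
  ext k
  rw [← angularFourier_two_pi_smul, smul_inv_smul₀ (by positivity)]

theorem integral_exp_mul_angularFourier {h : V → ℂ} (hc : Continuous h) (hi : Integrable h)
    (hF : Integrable (angularFourier h)) (v : V) :
    ∫ k, Complex.exp (Complex.I * (⟪k, v⟫ : ℝ)) * angularFourier h k =
      (2 * π) ^ Module.finrank ℝ V * h v := by
  have hF' : Integrable (𝓕 h) := by
    have := hF.comp_smul (R := 2 * π) (by positivity)
    simpa only [angularFourier_two_pi_smul] using this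
  have key := congrFun (hc.fourierInv_fourier_eq hi hF') v
  rw [Real.fourierInv_eq'] at key
  have hs := Measure.integral_comp_smul (volume : Measure V)
    (fun k ↦ Complex.exp (Complex.I * (⟪k, v⟫ : ℝ)) * angularFourier h k) (2 * π)
  rw [← key]
  have : ∀ w : V, Complex.exp (Complex.I * (⟪(2 * π) • w, v⟫ : ℝ)) *
      angularFourier h ((2 * π) • w) =
      Complex.exp ((2 * π * ⟪w, v⟫ : ℝ) * Complex.I) • 𝓕 h w := fun w ↦ by
    rw [angularFourier_two_pi_smul, smul_eq_mul, real_inner_smul_left, mul_comm Complex.I]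
  simp only [this] at hs
  rw [hs, abs_of_pos (by positivity), Complex.real_smul]
  push_cast
  rw [mul_inv_cancel_left₀]
  exact pow_ne_zero _ (by exact_mod_cast (by positivity : (2 * π : ℝ) ≠ 0))

theorem continuous_angularFourier_of_hasCompactSupport {h : V → ℂ} (hs : HasCompactSupport h)
    (hd : ContDiff ℝ ∞ h) : Continuous (angularFourier h) := by
  rw [angularFourier_eq]
  exact (𝓕 (hs.toSchwartzMap hd)).continuous.comp (continuous_const_smul _)

theorem integrable_angularFourier_of_hasCompactSupport {h : V → ℂ} (hs : HasCompactSupport h)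
    (hd : ContDiff ℝ ∞ h) : Integrable (angularFourier h) := by
  rw [angularFourier_eq]
  exact (𝓕 (hs.toSchwartzMap hd)).integrable.comp_smul (by positivity)

/-- The Fourier transform of a function of two vector variables. -/
def angularFourier₂ (Φ : V × V → ℂ) (q : V × V) : ℂ :=
  ∫ z, Complex.exp (-Complex.I * (⟪q.1, z.1⟫ + ⟪q.2, z.2⟫ : ℝ)) * Φ z

theorem angularFourier₂_eq (Φ : V × V → ℂ) (q : V × V) :
    angularFourier₂ Φ q = angularFourier (fun z : WithLp 2 (V × V) ↦ Φ (WithLp.ofLp z))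
      (WithLp.toLp 2 q) := by
  rw [angularFourier, angularFourier₂, ← (WithLp.volume_preserving_symm_measurableEquiv_toLp_prod
    V V).integral_comp (MeasurableEquiv.measurableEmbedding _)]
  rfl

theorem continuous_angularFourier₂ {Φ : V × V → ℂ} (hs : HasCompactSupport Φ)
    (hd : ContDiff ℝ ∞ Φ) : Continuous (angularFourier₂ Φ) := by
  rw [funext (angularFourier₂_eq Φ)]
  exact (continuous_angularFourier_of_hasCompactSupport (hasCompactSupport_comp_ofLp hs)
    (contDiff_comp_ofLp hd)).comp (WithLp.prodContinuousLinearEquiv 2 ℝ V V).symm.continuous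

theorem integrable_angularFourier₂ {Φ : V × V → ℂ} (hs : HasCompactSupport Φ)
    (hd : ContDiff ℝ ∞ Φ) : Integrable (angularFourier₂ Φ) := by
  rw [funext (angularFourier₂_eq Φ)]
  have hV := (WithLp.volume_preserving_symm_measurableEquiv_toLp_prod V V).symm
  exact hV.integrable_comp_of_integrable (integrable_angularFourier_of_hasCompactSupport
    (hasCompactSupport_comp_ofLp hs) (contDiff_comp_ofLp hd))

theorem integrable_exp_mul {α : Type*} [TopologicalSpace α] [MeasurableSpace α]
    [OpensMeasurableSpace α] {μ : Measure α} {h : α → ℂ} (hi : Integrable h μ) {φ : α → ℝ}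
    (hφ : Continuous φ) : Integrable (fun z ↦ Complex.exp (-Complex.I * (φ z : ℝ)) * h z) μ := by
  refine hi.bdd_mul (c := 1) (Continuous.aestronglyMeasurable (by fun_prop)) (.of_forall fun z ↦ ?_)
  rw [neg_mul, mul_comm, ← neg_mul, ← Complex.ofReal_neg, Complex.norm_exp_ofReal_mul_I]

theorem angularFourier₂_eq_angularFourier {Φ : V × V → ℂ} (hi : Integrable Φ) (k η : V) :
    angularFourier₂ Φ (k, η) =
      angularFourier (fun v ↦ angularFourier (fun x ↦ Φ (x, v)) k) η := by
  rw [angularFourier₂, Measure.volume_eq_prod, integral_prod_symm]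
  · refine integral_congr_ae (.of_forall fun v ↦ ?_)
    simp only [angularFourier]
    rw [← integral_const_mul]
    refine integral_congr_ae (.of_forall fun x ↦ ?_)
    simp only
    rw [← mul_assoc, ← Complex.exp_add]
    congr 2
    push_cast
    ring
  · exact integrable_exp_mul hi (by fun_prop)

theorem continuous_angularFourier_left {Φ : V × V → ℂ} (hs : HasCompactSupport Φ)
    (hc : Continuous Φ) (k : V) : Continuous fun v ↦ angularFourier (fun x ↦ Φ (x, v)) k := by
  have := continuous_parametric_integral_of_continuous (μ := (volume : Measure V))
    (f := fun v x ↦ Complex.exp (-Complex.I * (⟪k, x⟫ : ℝ)) * Φ (x, v)) (by fun_prop)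
    (hs.image continuous_fst)
  convert this using 2 with v
  refine (setIntegral_eq_integral_of_forall_compl_eq_zero fun x hx ↦ ?_).symm
  simp only
  rw [image_eq_zero_of_notMem_tsupport (fun h ↦ hx ⟨_, h, rfl⟩), mul_zero]

theorem measurePreserving_shear (t : ℝ) :
    MeasurePreserving (fun q : V × V ↦ (q.1 + t • q.2, q.2)) := by
  have : MeasurePreserving (fun q : V × V ↦ (q.1, q.2 + t • q.1)) :=
    (MeasurePreserving.id (volume : Measure V)).skew_product (g := fun v u ↦ u + t • v)
      (by fun_prop) (.of_forall fun v ↦ map_add_right_eq_self _ _)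
  exact (Measure.measurePreserving_swap.comp this).comp Measure.measurePreserving_swap

theorem angularFourier_integral_shear {Φ : V × V → ℂ} (hi : Integrable Φ) (t : ℝ) (k : V) :
    angularFourier (fun u ↦ ∫ v, Φ (u + t • v, v)) k = angularFourier₂ Φ (k, -(t • k)) := by
  have hS := measurePreserving_shear (V := V) t
  have hΦi := integrable_exp_mul hi
    (φ := fun z : V × V ↦ ⟪k, z.1⟫ + ⟪-(t • k), z.2⟫) (by fun_prop)
  have hΦi' := hS.integrable_comp_of_integrable hΦi
  rw [angularFourier₂, ← hS.map_eq, integral_map hS.aemeasurable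
    (by rw [hS.map_eq]; exact hΦi.aestronglyMeasurable), Measure.volume_eq_prod,
    integral_prod]
  rotate_left
  · exact hΦi'
  rw [angularFourier]
  refine integral_congr_ae (.of_forall fun u ↦ ?_)
  simp only
  rw [← integral_const_mul]
  refine integral_congr_ae (.of_forall fun v ↦ ?_)
  simp only [inner_add_right, inner_neg_left, real_inner_smul_left, real_inner_smul_right,
    add_neg_cancel_right]

theorem angularFourier_eq_of_norm_eq {h : V → ℂ} (hr : ∀ v w, ‖v‖ = ‖w‖ → h v = h w) {k l : V}
    (hkl : ‖k‖ = ‖l‖) : angularFourier h k = angularFourier h l := by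
  let A := (ℝ ∙ (k - l))ᗮ.reflection
  have hA : A k = l := Submodule.reflection_sub hkl
  have h1 := Real.fourier_comp_linearIsometry A h ((2 * π)⁻¹ • k)
  simp only [angularFourier_eq]
  rw [← hA, ← map_smul, ← h1]
  exact congrArg (fun g : V → ℂ ↦ 𝓕 g _) (funext fun v ↦ hr _ _ (A.norm_map v).symm)

theorem angularFourier₂_eq_of_norm_eq {Φ : V × V → ℂ} (hi : Integrable Φ)
    (hr : ∀ x v w, ‖v‖ = ‖w‖ → Φ (x, v) = Φ (x, w)) (k : V) {η ζ : V} (h : ‖η‖ = ‖ζ‖) :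
    angularFourier₂ Φ (k, η) = angularFourier₂ Φ (k, ζ) := by
  rw [angularFourier₂_eq_angularFourier hi, angularFourier₂_eq_angularFourier hi]
  exact angularFourier_eq_of_norm_eq (fun v w hvw ↦ by simp only [hr _ v w hvw]) h

theorem ae_ne_zero [Nontrivial V] : ∀ᵐ k : V, k ≠ 0 :=
  Measure.ae_ne volume 0

theorem integrable_dilated_angularFourier₂ [Nontrivial V] {Φ : V × V → ℂ}
    (hs : HasCompactSupport Φ) (hd : ContDiff ℝ ∞ Φ) {y : ℝ} (hy : 0 < y) :
    Integrable fun q : V × V ↦ ((‖q.1‖ ^ Module.finrank ℝ V : ℝ) : ℂ) *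
      angularFourier₂ Φ (q.1, (‖q.1‖ / y) • q.2) := by
  have hF := integrable_angularFourier₂ hs hd
  have hFc := continuous_angularFourier₂ hs hd
  rw [Measure.volume_eq_prod, integrable_prod_iff (Continuous.aestronglyMeasurable (by fun_prop))]
  have hne : ∀ᵐ k : V, k ≠ 0 := ae_ne_zero
  rw [Measure.volume_eq_prod] at hF
  constructor
  · filter_upwards [hF.prod_right_ae, hne] with k hk hk0
    have : ‖k‖ / y ≠ 0 := by positivity
    exact (hk.comp_smul this).const_mul _
  · refine (hF.integral_norm_prod_left.const_mul (y ^ Module.finrank ℝ V)).congr ?_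
    filter_upwards [hne] with k hk0
    have hk : 0 < ‖k‖ := norm_pos_iff.mpr hk0
    simp only [norm_mul, Complex.norm_real, norm_pow, norm_norm]
    rw [integral_const_mul, Measure.integral_comp_smul volume
      (fun w ↦ ‖angularFourier₂ Φ (k, w)‖), smul_eq_mul, ← mul_assoc]
    congr 1
    rw [abs_of_pos (by positivity), div_pow]
    field_simp

theorem integral_exp_mul_dilated_angularFourier₂ {Φ : V × V → ℂ} (hs : HasCompactSupport Φ)
    (hd : ContDiff ℝ ∞ Φ) {y : ℝ} (hy : 0 < y) (x : V) {k : V} (hk : k ≠ 0)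
    (hi : Integrable fun η ↦ angularFourier₂ Φ (k, η)) :
    ∫ u, ((‖k‖ ^ Module.finrank ℝ V : ℝ) : ℂ) *
        angularFourier₂ Φ (k, (‖k‖ / y) • (u - x)) * Complex.exp (Complex.I * (⟪k, u⟫ : ℝ)) =
      ((2 * π * y) ^ Module.finrank ℝ V : ℝ) * (Complex.exp (Complex.I * (⟪k, x⟫ : ℝ)) *
        angularFourier (fun z ↦ Φ (z, (y / ‖k‖) • k)) k) := by
  have hΦ : Integrable Φ := hd.continuous.integrable_of_hasCompactSupport hs
  have hk' : 0 < ‖k‖ := norm_pos_iff.mpr hk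
  rw [← integral_add_right_eq_self _ x]
  have h1 : ∀ u : V, ((‖k‖ ^ Module.finrank ℝ V : ℝ) : ℂ) *
        angularFourier₂ Φ (k, (‖k‖ / y) • (u + x - x)) *
          Complex.exp (Complex.I * (⟪k, u + x⟫ : ℝ)) =
      ((‖k‖ ^ Module.finrank ℝ V : ℝ) : ℂ) * Complex.exp (Complex.I * (⟪k, x⟫ : ℝ)) *
        (fun η ↦ Complex.exp (Complex.I * (⟪η, (y / ‖k‖) • k⟫ : ℝ)) *
          angularFourier₂ Φ (k, η)) ((‖k‖ / y) • u) := fun u ↦ by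
    have : ⟪(‖k‖ / y) • u, (y / ‖k‖) • k⟫ = ⟪k, u⟫ := by
      rw [real_inner_smul_left, real_inner_smul_right, real_inner_comm]
      field_simp
    simp only [this]
    rw [add_sub_cancel_right, inner_add_right, Complex.ofReal_add, mul_add, Complex.exp_add]
    ring
  simp only [h1]
  rw [integral_const_mul, Measure.integral_comp_smul volume (fun η ↦
    Complex.exp (Complex.I * (⟪η, (y / ‖k‖) • k⟫ : ℝ)) * angularFourier₂ Φ (k, η))]
  simp only [angularFourier₂_eq_angularFourier hΦ] at hi ⊢
  have hsec : HasCompactSupport fun v ↦ angularFourier (fun x ↦ Φ (x, v)) k := by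
    refine HasCompactSupport.intro (hs.image continuous_snd) fun v hv ↦ ?_
    simp only [angularFourier]
    refine integral_eq_zero_of_ae (.of_forall fun x ↦ ?_)
    simp only [Pi.zero_apply]
    rw [image_eq_zero_of_notMem_tsupport (fun h ↦ hv ⟨_, h, rfl⟩), mul_zero]
  have hcont := continuous_angularFourier_left hs hd.continuous k
  rw [integral_exp_mul_angularFourier hcont (hcont.integrable_of_hasCompactSupport hsec) hi,
    abs_of_pos (by positivity), Complex.real_smul]
  push_cast
  rw [div_pow, mul_pow _ (y : ℂ)]
  have : (‖k‖ : ℂ) ≠ 0 := by exact_mod_cast hk'.ne'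
  have : (y : ℂ) ≠ 0 := by exact_mod_cast hy.ne'
  field_simp

theorem integral_integral_dilated_angularFourier₂ [Nontrivial V] {Φ : V × V → ℂ}
    (hs : HasCompactSupport Φ) (hd : ContDiff ℝ ∞ Φ) {y : ℝ} (hy : 0 < y) (x : V) :
    ∫ u, ∫ k, ((‖k‖ ^ Module.finrank ℝ V : ℝ) : ℂ) *
        angularFourier₂ Φ (k, (‖k‖ / y) • (u - x)) * Complex.exp (Complex.I * (⟪k, u⟫ : ℝ)) =
      ((2 * π * y) ^ Module.finrank ℝ V : ℝ) * ∫ k, Complex.exp (Complex.I * (⟪k, x⟫ : ℝ)) *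
        angularFourier (fun z ↦ Φ (z, (y / ‖k‖) • k)) k := by
  have hF := integrable_angularFourier₂ hs hd
  rw [Measure.volume_eq_prod] at hF
  have hΦi : Integrable (fun q : V × V ↦ ((‖q.1‖ ^ Module.finrank ℝ V : ℝ) : ℂ) *
      angularFourier₂ Φ (q.1, (‖q.1‖ / y) • (q.2 - x)) *
        Complex.exp (Complex.I * (⟪q.1, q.2⟫ : ℝ))) (volume.prod volume) := by
    have h1 := ((MeasurePreserving.id (volume : Measure V)).prod
      (measurePreserving_sub_right volume x)).integrable_comp_of_integrable
      (integrable_dilated_angularFourier₂ hs hd hy)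
    refine (integrable_exp_mul h1 (φ := fun q : V × V ↦ -⟪q.1, q.2⟫) (by fun_prop)).congr
      (.of_forall fun q ↦ ?_)
    simp [mul_comm]
  rw [integral_integral_swap, ← integral_const_mul]
  · refine integral_congr_ae ?_
    filter_upwards [hF.prod_right_ae, ae_ne_zero] with k hk hk0
    exact integral_exp_mul_dilated_angularFourier₂ hs hd hy x hk0 hk
  · exact hΦi.swap

theorem integral_eq_integral_Ioi_sphere [Nontrivial V] {h : V → ℝ} (hi : Integrable h) :
    ∫ v, h v = ∫ r in Set.Ioi (0 : ℝ), r ^ (Module.finrank ℝ V - 1) *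
      ∫ n, h (r • (n : V)) ∂(volume : Measure V).toSphere := by
  have hmp := (volume : Measure V).measurePreserving_homeomorphUnitSphereProd
  have he := (homeomorphUnitSphereProd V).measurableEmbedding
  let g : sphere (0 : V) 1 × Set.Ioi (0 : ℝ) → ℝ := fun z ↦ h (z.2.1 • z.1.1)
  have hg : ∀ v : ({0}ᶜ : Set V), g (homeomorphUnitSphereProd V v) = h v := fun v ↦ by
    have : ‖(v : V)‖ ≠ 0 := norm_ne_zero_iff.mpr v.2
    simp [g, smul_smul, this]
  have hgi : Integrable g ((volume : Measure V).toSphere.prod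
      (Measure.volumeIoiPow (Module.finrank ℝ V - 1))) := by
    rw [← hmp.integrable_comp_emb he]
    simp only [Function.comp_def, hg]
    exact (integrableOn_iff_comap_subtypeVal (measurableSet_singleton _).compl).mp hi.integrableOn
  calc
    ∫ v, h v = ∫ v : ({0}ᶜ : Set V), h v ∂(volume.comap Subtype.val) := by
      rw [integral_subtype_comap (measurableSet_singleton _).compl h,
        restrict_compl_singleton]
    _ = ∫ z, g z ∂((volume : Measure V).toSphere.prod
        (Measure.volumeIoiPow (Module.finrank ℝ V - 1))) := by
      rw [← hmp.integral_comp he]; simp only [hg]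
    _ = ∫ r, ∫ n, g (n, r) ∂(volume : Measure V).toSphere
        ∂(Measure.volumeIoiPow (Module.finrank ℝ V - 1)) := integral_prod_symm _ hgi
    _ = _ := by
      simp only [Measure.volumeIoiPow, ENNReal.ofReal]
      rw [integral_withDensity_eq_integral_smul, integral_subtype_comap measurableSet_Ioi fun a ↦
        Real.toNNReal (a ^ (Module.finrank ℝ V - 1)) •
          ∫ n, h (a • (n : V)) ∂(volume : Measure V).toSphere,
        setIntegral_congr_fun measurableSet_Ioi fun x hx ↦ ?_]
      · rw [NNReal.smul_def, Real.coe_toNNReal _ (pow_nonneg hx.out.le _), smul_eq_mul]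
      · exact (measurable_subtype_coe.pow_const _).real_toNNReal

end Angular

section Kernel
open scoped ContDiff

variable {V : Type*} [NormedAddCommGroup V] [InnerProductSpace ℝ V]

/-- The function `(x, v) ↦ |v|^(-p) f(x, |v|)`, radial in its second argument, whose integrals over
the subspaces `{(u + t v, v)}` are the conical Radon transforms of `f`. -/
def radialLift (p : ℝ) (f : V × ℝ → ℝ) (q : V × V) : ℝ :=
  ‖q.2‖ ^ (-p) * f (q.1, ‖q.2‖)

theorem contDiff_radialLift (p : ℝ) {f : V × ℝ → ℝ} (hf : ContDiff ℝ ∞ f)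
    (hfs : tsupport f ⊆ {q | 0 < q.2}) : ContDiff ℝ ∞ (radialLift p f) := by
  rw [contDiff_iff_contDiffAt]
  rintro ⟨x, v⟩
  by_cases hv : v = 0
  · have hx : (x, ‖v‖) ∉ tsupport f := fun h ↦ by simpa [hv] using hfs h
    have h0 := notMem_tsupport_iff_eventuallyEq.mp hx
    have hc : Filter.Tendsto (fun q : V × V ↦ (q.1, ‖q.2‖)) (nhds (x, v)) (nhds (x, ‖v‖)) :=
      Continuous.tendsto (f := fun q : V × V ↦ (q.1, ‖q.2‖)) (by fun_prop) (x, v)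
    refine (contDiffAt_const (c := (0 : ℝ))).congr_of_eventuallyEq ?_
    filter_upwards [hc.eventually h0] with q hq
    simp [radialLift, hq]
  · have hn : ContDiffAt ℝ ∞ (fun q : V × V ↦ ‖q.2‖) (x, v) := contDiffAt_snd.norm ℝ hv
    exact (hn.rpow_const_of_ne (norm_ne_zero_iff.mpr hv)).mul
      (hf.contDiffAt.comp (x, v) (contDiffAt_fst.prodMk hn))

theorem hasCompactSupport_radialLift [FiniteDimensional ℝ V] (p : ℝ) {f : V × ℝ → ℝ}
    (hfc : HasCompactSupport f) : HasCompactSupport (radialLift p f) := by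
  have : ProperSpace V := FiniteDimensional.proper ℝ V
  obtain ⟨R, hR⟩ := hfc.isBounded.subset_closedBall 0
  refine HasCompactSupport.intro (isCompact_closedBall (0 : V × V) R) fun q hq ↦ ?_
  rw [radialLift, image_eq_zero_of_notMem_tsupport (f := f) fun h ↦ hq ?_, mul_zero]
  simpa [Prod.norm_def] using hR h

end Kernel

theorem finrank_euclideanSpace_pred (d : ℕ) :
    Module.finrank ℝ (EuclideanSpace ℝ (Fin (d - 1))) = d - 1 := by
  simp

theorem coneRadon_arctan (d : ℕ) (hd : 2 ≤ d) (p : ℝ)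
    {f : EuclideanSpace ℝ (Fin (d - 1)) × ℝ → ℝ} (hf : ContDiff ℝ (⊤ : ℕ∞) f)
    (hfc : HasCompactSupport f) (hfs : tsupport f ⊆ {q | 0 < q.2})
    (u : EuclideanSpace ℝ (Fin (d - 1))) (t : ℝ) :
    coneRadon d p f u (arctan t) =
      cos (arctan t) ^ (p - 1) * t ^ (d - 2) * ∫ v, radialLift p f (u + t • v, v) := by
  have : Nonempty (Fin (d - 1)) := ⟨⟨0, by omega⟩⟩
  have hc := cos_arctan_pos t
  set c := cos (arctan t)
  have hs : sin (arctan t) = t * c := by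
    rw [← tan_mul_cos hc.ne', tan_arctan]
  have hcont : Continuous fun v ↦ radialLift p f (u + t • v, v) :=
    (contDiff_radialLift p hf hfs).continuous.comp (by fun_prop)
  have hΦi : Integrable fun v ↦ radialLift p f (u + t • v, v) := by
    refine hcont.integrable_of_hasCompactSupport (HasCompactSupport.intro
      ((hasCompactSupport_radialLift p hfc).isCompact.image continuous_snd) fun v hv ↦ ?_)
    exact image_eq_zero_of_notMem_tsupport fun h ↦ hv ⟨_, h, rfl⟩
  rw [integral_eq_integral_Ioi_sphere hΦi, finrank_euclideanSpace_pred, coneRadon,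
    show d - 1 - 1 = d - 2 by omega]
  set G : ℝ → ℝ := fun r ↦ r ^ (d - 2) * ∫ n : sphere (0 : EuclideanSpace ℝ (Fin (d - 1))) 1,
    radialLift p f (u + t • r • n.1, r • n.1)
      ∂(volume : Measure (EuclideanSpace ℝ (Fin (d - 1)))).toSphere with hG
  have key : ∀ s ∈ Set.Ioi (0 : ℝ), s ^ (-p) *
      ∫ n, f (u + (s * sin (arctan t)) • (n : EuclideanSpace ℝ (Fin (d - 1))), s * c) *
          (s * sin (arctan t)) ^ (d - 2) ∂(sphereMeasure d) =
      (c ^ p * t ^ (d - 2)) * G (c * s) := by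
    intro s hs0
    have hs0 : 0 < s := hs0
    have hn : ∀ n : sphere (0 : EuclideanSpace ℝ (Fin (d - 1))) 1,
        radialLift p f (u + t • (c * s) • n.1, (c * s) • n.1) =
          (c * s) ^ (-p) * f (u + (s * sin (arctan t)) • n.1, s * c) := fun n ↦ by
      have : ‖(c * s) • n.1‖ = c * s := by
        rw [norm_smul, norm_eq_of_mem_sphere, mul_one, norm_of_nonneg (by positivity)]
      rw [radialLift, this, smul_smul, hs, show t * (c * s) = s * (t * c) by ring, mul_comm c s]
    simp only [hG, hn]
    rw [integral_mul_const, integral_const_mul, hs, sphereMeasure, mul_rpow hc.le hs0.le,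
      rpow_neg hc.le]
    have := (rpow_pos_of_pos hc p).ne'
    field_simp
    ring
  rw [setIntegral_congr_fun measurableSet_Ioi key, integral_const_mul,
    integral_comp_mul_left_Ioi G 0 hc, mul_zero, rpow_sub_one hc.ne', smul_eq_mul]
  ring

theorem backprojection_weight_mul (d : ℕ) (hd : 2 ≤ d) (p : ℝ) {a y : ℝ} (ha : 0 < a)
    (hy : 0 < y) :
    (a ^ 2 + y ^ 2) ^ ((p - 1) / 2) * a ^ ((2 : ℝ) - d) *
      (cos (arctan (a / y)) ^ (p - 1) * (a / y) ^ (d - 2)) = y ^ (p - 1) / y ^ (d - 2) := by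
  have h1 : a ^ 2 + y ^ 2 = y ^ 2 * (1 + (a / y) ^ 2) := by field_simp; ring
  have h2 : (0 : ℝ) < 1 + (a / y) ^ 2 := by positivity
  have h3 : (2 : ℝ) - d = -((d - 2 : ℕ) : ℝ) := by push_cast [Nat.cast_sub hd]; ring
  have h4 : (y ^ 2) ^ ((p - 1) / 2) = y ^ (p - 1) := by
    rw [← rpow_natCast, ← rpow_mul hy.le]; congr 1; push_cast; ring
  have h5 : √(1 + (a / y) ^ 2) ^ (p - 1) = (1 + (a / y) ^ 2) ^ ((p - 1) / 2) := by
    rw [sqrt_eq_rpow, ← rpow_mul h2.le]; congr 1; ring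
  rw [h1, mul_rpow (by positivity) h2.le, h4, cos_arctan, h3, rpow_neg ha.le, rpow_natCast,
    div_rpow zero_le_one (sqrt_nonneg _), one_rpow, h5, div_pow a y (d - 2)]
  have := (rpow_pos_of_pos h2 ((p - 1) / 2)).ne'
  field_simp

theorem fourierFirst_coneRadon_arctan (d : ℕ) (hd : 2 ≤ d) (p : ℝ)
    {f : EuclideanSpace ℝ (Fin (d - 1)) × ℝ → ℝ} (hf : ContDiff ℝ (⊤ : ℕ∞) f)
    (hfc : HasCompactSupport f) (hfs : tsupport f ⊆ {q | 0 < q.2})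
    (k : EuclideanSpace ℝ (Fin (d - 1))) (t : ℝ) :
    fourierFirst d (coneRadon d p f) k (arctan t) =
      ((cos (arctan t) ^ (p - 1) * t ^ (d - 2) : ℝ) : ℂ) *
        angularFourier₂ (fun q ↦ (radialLift p f q : ℂ)) (k, -(t • k)) := by
  have hΦi : Integrable fun q ↦ (radialLift p f q : ℂ) :=
    ((contDiff_radialLift p hf hfs).continuous.integrable_of_hasCompactSupport
      (hasCompactSupport_radialLift p hfc)).ofReal
  rw [← angularFourier_integral_shear hΦi, angularFourier, ← integral_const_mul,
    fourierFirst]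
  refine integral_congr_ae (.of_forall fun u ↦ ?_)
  simp only [coneRadon_arctan d hd p hf hfc hfs u t, Complex.ofReal_mul, integral_complex_ofReal]
  ring

theorem filteredData_arctan (d : ℕ) (hd : 2 ≤ d) (p : ℝ)
    {f : EuclideanSpace ℝ (Fin (d - 1)) × ℝ → ℝ} (hf : ContDiff ℝ (⊤ : ℕ∞) f)
    (hfc : HasCompactSupport f) (hfs : tsupport f ⊆ {q | 0 < q.2})
    (u w : EuclideanSpace ℝ (Fin (d - 1))) (y : ℝ) :
    filteredData d p f u (arctan (‖w‖ / y)) =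
      ((cos (arctan (‖w‖ / y)) ^ (p - 1) * (‖w‖ / y) ^ (d - 2) : ℝ) : ℂ) *
        (((2 * π) ^ (d - 1))⁻¹ * ∫ k, ((‖k‖ ^ (d - 1) : ℝ) : ℂ) *
          angularFourier₂ (fun q ↦ (radialLift p f q : ℂ)) (k, (‖k‖ / y) • w) *
            Complex.exp (Complex.I * (⟪k, u⟫ : ℝ))) := by
  have hΦi : Integrable fun q ↦ (radialLift p f q : ℂ) :=
    ((contDiff_radialLift p hf hfs).continuous.integrable_of_hasCompactSupport
      (hasCompactSupport_radialLift p hfc)).ofReal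
  have hpow : ((2 * π) ^ ((1 : ℤ) - (d : ℤ)) : ℝ) = ((2 * π) ^ (d - 1))⁻¹ := by
    rw [← zpow_natCast, ← zpow_neg]; congr 1; omega
  rw [filteredData, hpow, mul_left_comm]
  push_cast
  congr 1
  rw [← integral_const_mul]
  refine integral_congr_ae (.of_forall fun k ↦ ?_)
  have hnorm : ‖-((‖w‖ / y) • k)‖ = ‖(‖k‖ / y) • w‖ := by
    rw [norm_neg, norm_smul, norm_smul, norm_div, norm_div, norm_norm, norm_norm]
    ring
  simp only [fourierFirst_coneRadon_arctan d hd p hf hfc hfs k]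
  rw [angularFourier₂_eq_of_norm_eq hΦi
    (fun x v w hvw ↦ by simp only [radialLift, hvw]) k hnorm]
  push_cast
  ring

/-- filtered back-projection reconstruction, vertex parametrization:
for smooth `f` compactly supported in `ℝ^{d-1} × (0,∞)` and `y > 0`,
`f(x,y) = (2π)^{1-d} ∫_{ℝ^{d-1}} (|u-x|²+y²)^{(p-1)/2} |u-x|^{-(d-2)} g(u, arctan(|u-x|/y)) du`
where `g` is the Riesz-filtered data. -/
theorem coneRadon_fbp_vertex (d : ℕ) (hd : 2 ≤ d) (p : ℝ)
    (f : EuclideanSpace ℝ (Fin (d - 1)) × ℝ → ℝ)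
    (hf : ContDiff ℝ (⊤ : ℕ∞) f) (hfc : HasCompactSupport f)
    (hfs : tsupport f ⊆ {q : EuclideanSpace ℝ (Fin (d - 1)) × ℝ | 0 < q.2})
    (x : EuclideanSpace ℝ (Fin (d - 1))) (y : ℝ) (hy : 0 < y) :
    (f (x, y) : ℂ) =
      ((1 / (2 * π) ^ (d - 1) : ℝ) : ℂ) *
        ∫ u, (((‖u - x‖ ^ 2 + y ^ 2) ^ ((p - 1) / 2) * ‖u - x‖ ^ ((2 : ℝ) - d) : ℝ) : ℂ) *
          filteredData d p f u (Real.arctan (‖u - x‖ / y)) := by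
  have : Nonempty (Fin (d - 1)) := ⟨⟨0, by omega⟩⟩
  have hdim := finrank_euclideanSpace_pred d
  have hs : HasCompactSupport fun q ↦ (radialLift p f q : ℂ) :=
    (hasCompactSupport_radialLift p hfc).comp_left Complex.ofReal_zero
  have hsm : ContDiff ℝ (⊤ : ℕ∞) fun q ↦ (radialLift p f q : ℂ) :=
    Complex.ofRealCLM.contDiff.comp (contDiff_radialLift p hf hfs)
  have hfy : ContDiff ℝ (⊤ : ℕ∞) fun z ↦ (f (z, y) : ℂ) :=
    Complex.ofRealCLM.contDiff.comp (hf.comp (contDiff_id.prodMk contDiff_const))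
  have hfyc : HasCompactSupport fun z ↦ (f (z, y) : ℂ) := by
    refine HasCompactSupport.intro (hfc.isCompact.image continuous_fst) fun z hz ↦ ?_
    rw [image_eq_zero_of_notMem_tsupport fun h ↦ hz ⟨_, h, rfl⟩, Complex.ofReal_zero]
  have hinv := integral_exp_mul_angularFourier hfy.continuous
    (hfy.continuous.integrable_of_hasCompactSupport hfyc)
    (integrable_angularFourier_of_hasCompactSupport hfyc hfy) x
  have hback := integral_integral_dilated_angularFourier₂ hs hsm hy x
  have hk : ∀ᵐ k : EuclideanSpace ℝ (Fin (d - 1)),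
      Complex.exp (Complex.I * (⟪k, x⟫ : ℝ)) *
        angularFourier (fun z ↦ (radialLift p f (z, (y / ‖k‖) • k) : ℂ)) k =
      ((y ^ (-p) : ℝ) : ℂ) * (Complex.exp (Complex.I * (⟪k, x⟫ : ℝ)) *
        angularFourier (fun z ↦ (f (z, y) : ℂ)) k) := by
    filter_upwards [ae_ne_zero] with k hk0
    have hn : ‖(y / ‖k‖) • k‖ = y := by
      rw [norm_smul, norm_div, norm_norm, div_mul_cancel₀ _ (norm_ne_zero_iff.mpr hk0),
        norm_of_nonneg hy.le]
    simp only [radialLift, hn, Complex.ofReal_mul, angularFourier]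
    rw [mul_left_comm]
    congr 1
    rw [← integral_const_mul]
    refine integral_congr_ae (.of_forall fun z ↦ ?_)
    simp only
    ring
  rw [integral_congr_ae hk, integral_const_mul, hinv] at hback
  simp only [hdim] at hback
  have hu : ∀ᵐ u : EuclideanSpace ℝ (Fin (d - 1)),
      (((‖u - x‖ ^ 2 + y ^ 2) ^ ((p - 1) / 2) * ‖u - x‖ ^ ((2 : ℝ) - d) : ℝ) : ℂ) *
          filteredData d p f u (Real.arctan (‖u - x‖ / y)) =
      ((y ^ (p - 1) / y ^ (d - 2) * ((2 * π) ^ (d - 1))⁻¹ : ℝ) : ℂ) *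
        ∫ k, ((‖k‖ ^ (d - 1) : ℝ) : ℂ) *
          angularFourier₂ (fun q ↦ (radialLift p f q : ℂ)) (k, (‖k‖ / y) • (u - x)) *
            Complex.exp (Complex.I * (⟪k, u⟫ : ℝ)) := by
    filter_upwards [Measure.ae_ne volume x] with u hux
    have hw : u - x ≠ 0 := sub_ne_zero.mpr hux
    rw [filteredData_arctan d hd p hf hfc hfs u, ← mul_assoc, ← Complex.ofReal_mul,
      backprojection_weight_mul d hd p (norm_pos_iff.mpr hw) hy, ← mul_assoc]
    push_cast
    rfl
  rw [integral_congr_ae hu, integral_const_mul, hback]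
  have hconst : 1 / (2 * π) ^ (d - 1) * (y ^ (p - 1) / y ^ (d - 2) * ((2 * π) ^ (d - 1))⁻¹) *
      ((2 * π * y) ^ (d - 1) * (y ^ (-p) * (2 * π) ^ (d - 1))) = 1 := by
    have h1 : y ^ (d - 1) = y ^ (d - 2) * y := by rw [← pow_succ]; congr 1; omega
    have := (rpow_pos_of_pos hy p).ne'
    rw [mul_pow _ y, h1, rpow_sub_one hy.ne', rpow_neg hy.le]
    field_simp
  have hmul := congrArg (fun r : ℝ ↦ (r : ℂ) * (f (x, y) : ℂ)) hconst
  simp only [Complex.ofReal_one, one_mul] at hmul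
  refine hmul.symm.trans ?_
  push_cast
  ring
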